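/- Let M ∈ C_c^∞(ℝ²) satisfy the flag-F₁ seminorm bounds with constants 𝒞. For η ∈ ℝ define M_η(x) = ∫_ℝ e^{−2πiyη} M(x,y) dy. Then {M_η}_{η∈ℝ} is a uniformly bounded family of CZ kernels on ℝ: for every α ∈ ℕ there is a constant C''_α, and there is a constant C'', each depending only on 𝒞 (and in particular not on η or on the support of M), such that |∂_x^α M_η(x)| ≤ C''_α |x|^{−1−α} for all x ≠ 0, and |∫_ℝ M_η(x) φ(δx) dx| ≤ C'' for every δ > 0 and every normalized bump function φ. -/

import Mathlib

open Real Filter Topology MeasureTheory ENNReal NNReal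

noncomputable section

/-- `eI r = exp(i r)`. -/
def eI (r : ℝ) : ℂ := Complex.exp (Complex.I * r)

/-- A normalized bump function on `ℝ`: a `C^∞` function supported in `[-1,1]`
with `|φ| ≤ 1` and `|φ'| ≤ 1`. -/
def IsNormalizedBump (φ : ℝ → ℝ) : Prop :=
  ContDiff ℝ (⊤ : ℕ∞) φ ∧ (∀ t : ℝ, 1 < |t| → φ t = 0) ∧
  (∀ t, |φ t| ≤ 1) ∧ (∀ t, |deriv φ t| ≤ 1)

/-- A compactly supported smooth function `M` on `ℝ²` satisfies the flag-`F₁` seminorm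
bounds with constants `𝒞 = (Cab, C1, C2)` if:
(i) `|∂_x^α ∂_y^β M(x,y)| ≤ Cab α β (|x|+|y|^{1/2})^{-1-α} |y|^{-1-β}` for `y ≠ 0`;
(ii) for every normalized bump `φ` and `R > 0`, the functions
`y ↦ ∫ M(x,y) φ(Rx) dx` and `x ↦ ∫ M(x,y) φ(Ry) dy` are CZ kernels on `ℝ`
with constants `(C1, C2)` (decay and cancellation), uniformly in `φ` and `R`. -/
def FlagF1FunBounds (Cab : ℕ → ℕ → ℝ) (C1 : ℕ → ℝ) (C2 : ℝ) (M : ℝ → ℝ → ℂ) : Prop :=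
  ContDiff ℝ (⊤ : ℕ∞) (fun p : ℝ × ℝ => M p.1 p.2) ∧
  HasCompactSupport (fun p : ℝ × ℝ => M p.1 p.2) ∧
  (∀ (α β : ℕ) (x y : ℝ), y ≠ 0 →
    ‖iteratedDeriv α (fun x' : ℝ => iteratedDeriv β (fun y' : ℝ => M x' y') y) x‖
      ≤ Cab α β * (|x| + |y| ^ ((1:ℝ)/2)) ^ (-1 - (α : ℝ)) * |y| ^ (-1 - (β : ℝ))) ∧
  (∀ φ : ℝ → ℝ, IsNormalizedBump φ → ∀ R : ℝ, 0 < R →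
    (∀ (α : ℕ) (y : ℝ), y ≠ 0 →
      ‖iteratedDeriv α (fun y' : ℝ => ∫ x : ℝ, M x y' * (φ (R * x) : ℂ)) y‖
        ≤ C1 α * |y| ^ (-1 - (α : ℝ))) ∧
    (∀ δ : ℝ, 0 < δ → ∀ ψ : ℝ → ℝ, IsNormalizedBump ψ →
      ‖∫ y : ℝ, (∫ x : ℝ, M x y * (φ (R * x) : ℂ)) * (ψ (δ * y) : ℂ)‖ ≤ C2) ∧
    (∀ (α : ℕ) (x : ℝ), x ≠ 0 →
      ‖iteratedDeriv α (fun x' : ℝ => ∫ y : ℝ, M x' y * (φ (R * y) : ℂ)) x‖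
        ≤ C1 α * |x| ^ (-1 - (α : ℝ))) ∧
    (∀ δ : ℝ, 0 < δ → ∀ ψ : ℝ → ℝ, IsNormalizedBump ψ →
      ‖∫ x : ℝ, (∫ y : ℝ, M x y * (φ (R * y) : ℂ)) * (ψ (δ * x) : ℂ)‖ ≤ C2))

/-- A smooth compactly supported function of two variables, in curried form. -/
def IsTestFun (M : ℝ → ℝ → ℂ) : Prop :=
  ContDiff ℝ (⊤ : ℕ∞) (fun p : ℝ × ℝ => M p.1 p.2) ∧
  HasCompactSupport (fun p : ℝ × ℝ => M p.1 p.2)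

/-- The partial derivative in the first variable. -/
def fstDeriv (M : ℝ → ℝ → ℂ) (x y : ℝ) : ℂ := deriv (fun x' => M x' y) x

/-- The partial derivative in the second variable. -/
def sndDeriv (M : ℝ → ℝ → ℂ) (x y : ℝ) : ℂ := deriv (fun y' => M x y') y

namespace IsTestFun

variable {M : ℝ → ℝ → ℂ}

lemma swap (h : IsTestFun M) : IsTestFun (fun x y => M y x) :=
  ⟨h.1.comp (contDiff_snd.prodMk contDiff_fst),
    h.2.comp_homeomorph (Homeomorph.prodComm ℝ ℝ)⟩

lemma differentiable (h : IsTestFun M) : Differentiable ℝ (fun p : ℝ × ℝ => M p.1 p.2) :=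
  h.1.differentiable (by simp)

lemma continuous (h : IsTestFun M) : Continuous (fun p : ℝ × ℝ => M p.1 p.2) := h.1.continuous

lemma hasDerivAt_fst (h : IsTestFun M) (x y : ℝ) :
    HasDerivAt (fun x' => M x' y) (fderiv ℝ (fun p : ℝ × ℝ => M p.1 p.2) (x, y) (1, 0)) x :=
  (h.differentiable (x, y)).hasFDerivAt.comp_hasDerivAt (f := fun x' : ℝ => (x', y)) x
    ((hasDerivAt_id x).prodMk (hasDerivAt_const x y))

lemma hasDerivAt_snd (h : IsTestFun M) (x y : ℝ) :
    HasDerivAt (fun y' => M x y') (fderiv ℝ (fun p : ℝ × ℝ => M p.1 p.2) (x, y) (0, 1)) y :=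
  (h.differentiable (x, y)).hasFDerivAt.comp_hasDerivAt (f := fun y' : ℝ => (x, y')) y
    ((hasDerivAt_const y x).prodMk (hasDerivAt_id y))

lemma fderiv_apply (h : IsTestFun M) (v : ℝ × ℝ) :
    ContDiff ℝ (⊤ : ℕ∞) (fun p => fderiv ℝ (fun p : ℝ × ℝ => M p.1 p.2) p v) ∧
    HasCompactSupport (fun p => fderiv ℝ (fun p : ℝ × ℝ => M p.1 p.2) p v) :=
  ⟨(h.1.fderiv_right (by simp)).clm_apply contDiff_const, h.2.fderiv_apply ℝ v⟩

lemma fstDeriv_eq (h : IsTestFun M) :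
    fstDeriv M = fun x y => fderiv ℝ (fun p : ℝ × ℝ => M p.1 p.2) (x, y) (1, 0) :=
  funext₂ fun x y => (h.hasDerivAt_fst x y).deriv

lemma sndDeriv_eq (h : IsTestFun M) :
    sndDeriv M = fun x y => fderiv ℝ (fun p : ℝ × ℝ => M p.1 p.2) (x, y) (0, 1) :=
  funext₂ fun x y => (h.hasDerivAt_snd x y).deriv

lemma fstDeriv (h : IsTestFun M) : IsTestFun (fstDeriv M) := by
  rw [h.fstDeriv_eq]; exact h.fderiv_apply (1, 0)

lemma sndDeriv (h : IsTestFun M) : IsTestFun (sndDeriv M) := by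
  rw [h.sndDeriv_eq]; exact h.fderiv_apply (0, 1)

lemma iterate_fstDeriv (h : IsTestFun M) (n : ℕ) : IsTestFun (_root_.fstDeriv^[n] M) := by
  induction n with
  | zero => exact h
  | succ n ih => rw [Function.iterate_succ_apply']; exact ih.fstDeriv

lemma sndDeriv_fstDeriv (h : IsTestFun M) :
    _root_.sndDeriv (_root_.fstDeriv M) = _root_.fstDeriv (_root_.sndDeriv M) := by
  have key : ∀ v w p, fderiv ℝ (fun q => fderiv ℝ (fun p : ℝ × ℝ => M p.1 p.2) q v) p w
      = fderiv ℝ (fderiv ℝ (fun p : ℝ × ℝ => M p.1 p.2)) p w v := by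
    intro v w p
    have hd : DifferentiableAt ℝ (fderiv ℝ (fun p : ℝ × ℝ => M p.1 p.2)) p :=
      (h.1.fderiv_right (m := (⊤ : ℕ∞)) (by simp)).differentiable (by simp) p
    have := (hd.hasFDerivAt.clm_apply (hasFDerivAt_const v p)).fderiv
    rw [this]; simp
  rw [h.fstDeriv.sndDeriv_eq, h.sndDeriv.fstDeriv_eq]
  funext x y
  simp only [h.fstDeriv_eq, h.sndDeriv_eq, Prod.mk.eta, key]
  exact (h.1.contDiffAt.isSymmSndFDerivAt (by
    simp only [minSmoothness_of_isRCLikeNormedField]; exact WithTop.coe_le_coe.2 (le_top : (2 : ℕ∞) ≤ ⊤))).eq _ _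

lemma sndDeriv_iterate_fstDeriv (h : IsTestFun M) (n : ℕ) :
    _root_.sndDeriv (_root_.fstDeriv^[n] M) = _root_.fstDeriv^[n] (_root_.sndDeriv M) := by
  induction n with
  | zero => rfl
  | succ n ih =>
    rw [Function.iterate_succ_apply', Function.iterate_succ_apply',
      (h.iterate_fstDeriv n).sndDeriv_fstDeriv, ih]

lemma exists_compact (h : IsTestFun M) :
    ∃ L : Set ℝ, IsCompact L ∧ ∀ x y, y ∉ L → M x y = 0 := by
  refine ⟨Prod.snd '' tsupport (fun p : ℝ × ℝ => M p.1 p.2),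
    IsCompact.image h.2 continuous_snd, fun x y hy => ?_⟩
  by_contra hne
  exact hy ⟨(x, y), subset_tsupport _ hne, rfl⟩

lemma hasCompactSupport_snd (h : IsTestFun M) (x : ℝ) : HasCompactSupport (M x) := by
  obtain ⟨L, hL, h0⟩ := h.exists_compact
  exact HasCompactSupport.intro hL fun y hy => h0 x y hy

lemma continuous_snd (h : IsTestFun M) (x : ℝ) : Continuous (M x) :=
  h.continuous.comp (Continuous.prodMk_right x)

lemma integrable_mul (h : IsTestFun M) {G : ℝ → ℂ} (hG : Continuous G) (x : ℝ) :
    Integrable (fun y => M x y * G y) :=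
  ((h.continuous_snd x).mul hG).integrable_of_hasCompactSupport
    (h.hasCompactSupport_snd x).mul_right

lemma hasDerivAt_integral (h : IsTestFun M) {G : ℝ → ℂ} (hG : Continuous G) (x : ℝ) :
    HasDerivAt (fun x' => ∫ y, M x' y * G y) (∫ y, _root_.fstDeriv M x y * G y) x := by
  obtain ⟨L, hL, h0⟩ := h.fstDeriv.exists_compact
  obtain ⟨C, hC⟩ := h.fstDeriv.2.exists_bound_of_continuous h.fstDeriv.continuous
  refine (hasDerivAt_integral_of_dominated_loc_of_deriv_le (s := Set.univ)
    (F := fun x' y => M x' y * G y) (F' := fun x' y => _root_.fstDeriv M x' y * G y)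
    (bound := L.indicator fun y => C * ‖G y‖) Filter.univ_mem
    (.of_forall fun x' => (h.integrable_mul hG x').aestronglyMeasurable)
    (h.integrable_mul hG x) (h.fstDeriv.integrable_mul hG x).aestronglyMeasurable
    (.of_forall fun y x' _ => ?_) ?_ (.of_forall fun y x' _ => ?_)).2
  · by_cases hy : y ∈ L
    · rw [Set.indicator_of_mem hy, norm_mul]
      exact mul_le_mul_of_nonneg_right (hC (x', y)) (norm_nonneg _)
    · simp [h0 x' y hy, hy]
  · exact ((continuous_const.mul hG.norm).continuousOn.integrableOn_compact hL).integrable_indicator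
      hL.measurableSet
  · exact ((h.hasDerivAt_fst x' y).differentiableAt.hasDerivAt).mul_const (G y)

lemma iteratedDeriv_fst (M : ℝ → ℝ → ℂ) (n : ℕ) (x y : ℝ) :
    iteratedDeriv n (fun x' => M x' y) x = _root_.fstDeriv^[n] M x y := by
  induction n generalizing x with
  | zero => simp
  | succ n ih =>
    rw [iteratedDeriv_succ, Function.iterate_succ_apply', _root_.fstDeriv]
    congr 1
    exact funext ih

lemma iteratedDeriv_integral (h : IsTestFun M) {G : ℝ → ℂ} (hG : Continuous G) (n : ℕ) (x : ℝ) :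
    iteratedDeriv n (fun x' => ∫ y, M x' y * G y) x = ∫ y, _root_.fstDeriv^[n] M x y * G y := by
  induction n generalizing x with
  | zero => simp
  | succ n ih =>
    rw [iteratedDeriv_succ, funext ih, ((h.iterate_fstDeriv n).hasDerivAt_integral hG x).deriv]
    simp only [Function.iterate_succ_apply']

lemma contDiff_integral (h : IsTestFun M) {G : ℝ → ℂ} (hG : Continuous G) :
    ContDiff ℝ 1 (fun x => ∫ y, M x y * G y) := by
  refine contDiff_one_iff_deriv.2
    ⟨fun x => (h.hasDerivAt_integral hG x).differentiableAt, ?_⟩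
  rw [funext fun x => (h.hasDerivAt_integral hG x).deriv]
  exact continuous_iff_continuousAt.2 fun x =>
    (h.fstDeriv.hasDerivAt_integral hG x).continuousAt

end IsTestFun

/-- A smooth cutoff with values in `[0, 1]` and bounded derivative, equal to `1` on
`[-1/2, 1/2]` and supported in `[-1, 1]`. -/
lemma exists_cutoff : ∃ (χ : ℝ → ℝ) (D : ℝ), 0 ≤ D ∧ ContDiff ℝ (⊤ : ℕ∞) χ ∧
    (∀ t, |t| ≤ 1 / 2 → χ t = 1) ∧ (∀ t, 1 < |t| → χ t = 0) ∧
    (∀ t, |χ t| ≤ 1) ∧ (∀ t, |1 - χ t| ≤ 1) ∧ ∀ t, |deriv χ t| ≤ D := by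
  let b : ContDiffBump (0 : ℝ) := ⟨1 / 2, 1, by norm_num, by norm_num⟩
  have hb : ContDiff ℝ (⊤ : ℕ∞) b := b.contDiff
  obtain ⟨D, hD⟩ := b.hasCompactSupport.deriv.exists_bound_of_continuous
    (hb.continuous_deriv (by simp))
  have h0 : ∀ t, 0 ≤ b t := fun t => b.nonneg
  have h1 : ∀ t, b t ≤ 1 := fun t => b.le_one
  refine ⟨b, D, (norm_nonneg _).trans (hD 0), hb, fun t ht => ?_, fun t ht => ?_, fun t => ?_,
    fun t => ?_, hD⟩
  · exact b.one_of_mem_closedBall (by simpa [b] using ht)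
  · exact b.zero_of_le_dist (by simpa [b] using ht.le)
  · exact abs_le.2 ⟨by linarith [h0 t], h1 t⟩
  · exact abs_le.2 ⟨by linarith [h1 t], by linarith [h0 t]⟩

/-- Modulating a cutoff by a wave of frequency at most one gives a multiple of a normalized
bump. -/
lemma isNormalizedBump_mul_wave {χ : ℝ → ℝ} {D c s : ℝ} (hχ : ContDiff ℝ (⊤ : ℕ∞) χ)
    (hsupp : ∀ t, 1 < |t| → χ t = 0) (hle : ∀ t, |χ t| ≤ 1) (hD : ∀ t, |deriv χ t| ≤ D)
    (hc : 0 < c) (hc1 : c ≤ 1) (hcD : c * (2 * π + D) ≤ 1) (hs : |s| ≤ 1) {w : ℝ → ℝ}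
    (hw : ContDiff ℝ (⊤ : ℕ∞) w) (hw1 : ∀ t, |w t| ≤ 1) (hw2 : ∀ t, |deriv w t| ≤ 1) :
    IsNormalizedBump (fun t => c * (w (2 * π * s * t) * χ t)) := by
  have hwd : ∀ t, HasDerivAt (fun t => w (2 * π * s * t))
      (deriv w (2 * π * s * t) * (2 * π * s)) t := fun t => by
    have h1 : HasDerivAt (fun t => 2 * π * s * t) (2 * π * s) t := by
      simpa using (hasDerivAt_id t).const_mul (2 * π * s)
    exact ((hw.differentiable (by simp) _).hasDerivAt).comp t h1
  refine ⟨contDiff_const.mul ((hw.comp (contDiff_const.mul contDiff_id)).mul hχ),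
    fun t ht => by simp [hsupp t ht], fun t => ?_, fun t => ?_⟩
  · rw [abs_mul, abs_mul, abs_of_pos hc]
    exact mul_le_one₀ hc1 (by positivity) (mul_le_one₀ (hw1 _) (abs_nonneg _) (hle t))
  · have hd : HasDerivAt (fun t => c * (w (2 * π * s * t) * χ t)) _ t :=
      ((hwd t).mul (hχ.differentiable (by simp) t).hasDerivAt).const_mul c
    rw [hd.deriv, abs_mul, abs_of_pos hc]
    refine le_trans (mul_le_mul_of_nonneg_left ?_ hc.le) hcD
    refine (abs_add_le _ _).trans (add_le_add ?_ ?_)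
    · rw [abs_mul, abs_mul, abs_mul (2 * π), abs_of_pos two_pi_pos]
      have h1 : |deriv w (2 * π * s * t)| * (2 * π * |s|) ≤ 1 * (2 * π * 1) := by
        gcongr; exact hw2 _
      calc _ ≤ (1 * (2 * π * 1)) * 1 :=
            mul_le_mul h1 (hle t) (abs_nonneg _) (by positivity)
        _ = 2 * π := by ring
    · rw [abs_mul]
      calc _ ≤ 1 * D := mul_le_mul (hw1 _) (hD t) (abs_nonneg _) zero_le_one
        _ = D := one_mul D

lemma continuous_eI_mul (η : ℝ) : Continuous fun y : ℝ => eI (-2 * π * y * η) := by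
  unfold eI; fun_prop

lemma norm_eI (r : ℝ) : ‖eI r‖ = 1 := by
  rw [eI, mul_comm]; exact Complex.norm_exp_ofReal_mul_I r

/-- Integration by parts against an oscillating exponential. -/
lemma norm_integral_eI_mul_le {g : ℝ → ℂ} (hg : ContDiff ℝ 1 g) (hgc : HasCompactSupport g)
    {η : ℝ} (hη : η ≠ 0) :
    ‖∫ y, eI (-2 * π * y * η) * g y‖ ≤ (∫ y, ‖deriv g y‖) / (2 * π * |η|) := by
  have he : ∀ y : ℝ, HasDerivAt (fun y : ℝ => eI (-2 * π * y * η))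
      ((-(2 * π * η) * Complex.I : ℂ) * eI (-2 * π * y * η)) y := by
    intro y
    have h1 : HasDerivAt (fun y : ℝ => Complex.I * ((-2 * π * y * η : ℝ) : ℂ))
        (Complex.I * ((-2 * π * 1 * η : ℝ) : ℂ)) y :=
      ((((hasDerivAt_id y).const_mul (-2 * π)).mul_const η).ofReal_comp).const_mul _
    refine HasDerivAt.congr_deriv (f := fun y : ℝ => eI (-2 * π * y * η)) h1.cexp ?_
    unfold eI
    push_cast
    ring
  have hdc : Continuous (deriv g) := hg.continuous_deriv le_rfl
  have hec := continuous_eI_mul η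
  have hpart : ∫ y, eI (-2 * π * y * η) * deriv g y
      = -∫ y, ((-(2 * π * η) * Complex.I : ℂ) * eI (-2 * π * y * η)) * g y := by
    refine integral_mul_deriv_eq_deriv_mul_of_integrable (fun y _ => he y)
      (fun y _ => (hg.differentiable one_ne_zero y).hasDerivAt) ?_ ?_ ?_
    · exact (hec.mul hdc).integrable_of_hasCompactSupport hgc.deriv.mul_left
    · exact ((continuous_const.mul hec).mul hg.continuous).integrable_of_hasCompactSupport
        hgc.mul_left
    · exact (hec.mul hg.continuous).integrable_of_hasCompactSupport hgc.mul_left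
  have hpos : 0 < 2 * π * |η| := by positivity
  rw [le_div_iff₀ hpos]
  calc ‖∫ y, eI (-2 * π * y * η) * g y‖ * (2 * π * |η|)
      = ‖∫ y, eI (-2 * π * y * η) * deriv g y‖ := by
        rw [hpart]
        simp only [mul_assoc (-(2 * π * η) * Complex.I : ℂ)]
        rw [integral_const_mul, norm_neg, norm_mul, mul_comm]
        congr 1
        simp [abs_of_pos Real.pi_pos]
    _ ≤ ∫ y, ‖eI (-2 * π * y * η) * deriv g y‖ := norm_integral_le_integral_norm _
    _ = ∫ y, ‖deriv g y‖ := by simp [norm_eI]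

/-- The Fourier transform of a Calderón-Zygmund kernel is bounded in terms of the kernel
constants only. -/
lemma exists_norm_integral_eI_mul_le : ∃ E : ℝ, 0 ≤ E ∧ ∀ (K : ℝ → ℂ) (A B : ℝ),
    ContDiff ℝ 1 K → HasCompactSupport K →
    (∀ y, y ≠ 0 → ‖K y‖ ≤ A * |y|⁻¹) → (∀ y, y ≠ 0 → ‖deriv K y‖ ≤ A * (|y| ^ 2)⁻¹) →
    (∀ R : ℝ, 0 < R → ∀ φ : ℝ → ℝ, IsNormalizedBump φ → ‖∫ y, K y * (φ (R * y) : ℂ)‖ ≤ B) →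
    ∀ η : ℝ, ‖∫ y, eI (-2 * π * y * η) * K y‖ ≤ E * (A + B) := by
  obtain ⟨χ, D, hD0, hχ, hχ1, hχ0, hχle, hχle', hχD⟩ := exists_cutoff
  set c : ℝ := (2 * π + D + 1)⁻¹ with hc
  have hpi := Real.pi_pos
  have hcpos : 0 < c := by positivity
  have hc1 : c ≤ 1 := inv_le_one_of_one_le₀ (by linarith)
  have hcD : c * (2 * π + D) ≤ 1 := by
    rw [hc, inv_mul_le_iff₀ (by positivity)]; linarith
  have hbcos : ∀ s : ℝ, |s| ≤ 1 →
      IsNormalizedBump (fun t => c * (Real.cos (2 * π * s * t) * χ t)) := fun s hs =>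
    isNormalizedBump_mul_wave hχ hχ0 hχle hχD hcpos hc1 hcD hs Real.contDiff_cos
      Real.abs_cos_le_one (fun t => by simpa using Real.abs_sin_le_one t)
  have hbsin : ∀ s : ℝ, |s| ≤ 1 →
      IsNormalizedBump (fun t => c * (Real.sin (2 * π * s * t) * χ t)) := fun s hs =>
    isNormalizedBump_mul_wave hχ hχ0 hχle hχD hcpos hc1 hcD hs Real.contDiff_sin
      Real.abs_sin_le_one (fun t => by simpa using Real.abs_cos_le_one t)
  refine ⟨2 / c + 5 * (1 + D) / 2, by positivity, ?_⟩
  intro K A B hK hKc hK0 hK1 hKB η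
  have hA : 0 ≤ A := by simpa using (norm_nonneg _).trans (hK0 1 one_ne_zero)
  have hB : 0 ≤ B := (norm_nonneg _).trans (hKB 1 one_pos _ (hbcos 0 (by simp)))
  have hlow : ∀ R : ℝ, 0 < R → |η| ≤ R →
      ‖∫ y, eI (-2 * π * y * η) * (K y * (χ (R * y) : ℂ))‖ ≤ 2 / c * B := by
    intro R hR hηR
    have hs : |η / R| ≤ 1 := by
      rw [abs_div, abs_of_pos hR]; exact (div_le_one hR).2 hηR
    have harg : ∀ y, 2 * π * (η / R) * (R * y) = 2 * π * y * η := fun y => by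
      field_simp
    have h1 := hKB R hR _ (hbcos _ hs)
    have h2 := hKB R hR _ (hbsin _ hs)
    simp only [harg] at h1 h2
    have hi : ∀ w : ℝ → ℝ, Continuous w →
        Integrable fun y => K y * ((c * (w (2 * π * y * η) * χ (R * y)) : ℝ) : ℂ) := by
      intro w hw
      have := hχ.continuous
      exact (hK.continuous.mul (by fun_prop)).integrable_of_hasCompactSupport hKc.mul_right
    have heq : ∫ y, eI (-2 * π * y * η) * (K y * (χ (R * y) : ℂ))
        = (c : ℂ)⁻¹ * ((∫ y, K y * ((c * (Real.cos (2 * π * y * η) * χ (R * y)) : ℝ) : ℂ))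
          - Complex.I *
            ∫ y, K y * ((c * (Real.sin (2 * π * y * η) * χ (R * y)) : ℝ) : ℂ)) := by
      rw [← integral_const_mul, ← integral_sub (hi _ Real.continuous_cos)
        ((hi _ Real.continuous_sin).const_mul _), ← integral_const_mul]
      congr 1
      funext y
      have hcne : (c : ℂ) ≠ 0 := by exact_mod_cast hcpos.ne'
      have : eI (-2 * π * y * η)
          = (Real.cos (2 * π * y * η) : ℂ) - Complex.I * (Real.sin (2 * π * y * η) : ℂ) := by
        rw [eI, mul_comm, Complex.exp_mul_I, ← Complex.ofReal_cos, ← Complex.ofReal_sin,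
          show -2 * π * y * η = -(2 * π * y * η) by ring, Real.cos_neg, Real.sin_neg]
        push_cast; ring
      rw [this]
      push_cast
      field_simp
    rw [heq, norm_mul, norm_inv, Complex.norm_real, Real.norm_of_nonneg hcpos.le]
    have h3 := norm_sub_le
      (∫ y, K y * ((c * (Real.cos (2 * π * y * η) * χ (R * y)) : ℝ) : ℂ))
      (Complex.I * ∫ y, K y * ((c * (Real.sin (2 * π * y * η) * χ (R * y)) : ℝ) : ℂ))
    rw [norm_mul, Complex.norm_I, one_mul] at h3
    calc _ ≤ c⁻¹ * (B + B) := by gcongr; linarith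
      _ = _ := by ring
  rcases eq_or_ne η 0 with rfl | hη
  · obtain ⟨r, hr⟩ := hKc.isCompact.isBounded.subset_closedBall (0 : ℝ)
    have hRpos : 0 < (2 * (|r| + 1))⁻¹ := by positivity
    have h := hlow _ hRpos (by simpa using hRpos.le)
    have heq : ∀ y, K y * (χ ((2 * (|r| + 1))⁻¹ * y) : ℂ) = K y := by
      intro y
      by_cases hy : K y = 0
      · simp [hy]
      have hyr : |y| ≤ r := by simpa using hr (subset_tsupport _ hy)
      rw [hχ1, Complex.ofReal_one, mul_one]
      rw [abs_mul, abs_of_pos hRpos, inv_mul_le_iff₀ (by positivity)]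
      linarith [le_abs_self r]
    simp only [heq] at h
    refine h.trans ?_
    have : 0 ≤ 5 * (1 + D) / 2 * (A + B) + 2 / c * A := by positivity
    linarith
  set R := |η| with hRdef
  have hR : 0 < R := abs_pos.2 hη
  set g : ℝ → ℂ := fun y => K y * ((1 - χ (R * y) : ℝ) : ℂ) with hg
  have hχR : ContDiff ℝ 1 (fun y => ((1 - χ (R * y) : ℝ) : ℂ)) :=
    Complex.ofRealCLM.contDiff.comp (contDiff_const.sub
      ((hχ.of_le (by exact_mod_cast le_top)).comp (contDiff_const.mul contDiff_id)))
  have hgC : ContDiff ℝ 1 g := hK.mul hχR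
  have hgc : HasCompactSupport g := hKc.mul_right
  have hgd : ∀ y, deriv g y = deriv K y * ((1 - χ (R * y) : ℝ) : ℂ)
      + K y * ((-(deriv χ (R * y) * R) : ℝ) : ℂ) := by
    intro y
    have h1 : HasDerivAt (fun y => R * y) R y := by
      simpa using (hasDerivAt_id y).const_mul R
    have h2 : HasDerivAt (fun y => 1 - χ (R * y)) (-(deriv χ (R * y) * R)) y := by
      simpa using (((hχ.differentiable (by simp) _).hasDerivAt).comp y h1).const_sub 1
    exact ((hK.differentiable one_ne_zero y).hasDerivAt.mul h2.ofReal_comp).deriv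
  have hderivχ : ∀ t : ℝ, 1 < |t| → deriv χ t = 0 := by
    intro t ht
    have : χ =ᶠ[𝓝 t] fun _ => 0 := by
      filter_upwards [(isOpen_lt continuous_const continuous_abs).mem_nhds ht] with u hu
      exact hχ0 u hu
    rw [this.deriv_eq, deriv_const]
  have hderivχ' : ∀ t : ℝ, |t| < 1 / 2 → deriv χ t = 0 := by
    intro t ht
    have : χ =ᶠ[𝓝 t] fun _ => 1 := by
      filter_upwards [(isOpen_lt continuous_abs continuous_const).mem_nhds ht] with u hu
      exact hχ1 u (le_of_lt hu)
    rw [this.deriv_eq, deriv_const]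
  have hgbound : ∀ y, ‖deriv g y‖ ≤ 5 * A * (1 + D) * R ^ 2 * (1 + (R * y) ^ 2)⁻¹ := by
    intro y
    rcases lt_or_ge |R * y| (1 / 2) with hy | hy
    · rw [hgd, hχ1 _ hy.le, hderivχ' _ hy]
      simp only [sub_self, zero_mul, neg_zero, Complex.ofReal_zero, mul_zero, add_zero, norm_zero]
      positivity
    have hRy : |R * y| = R * |y| := by rw [abs_mul, abs_of_pos hR]
    have hypos : 0 < |y| := by
      rw [hRy] at hy
      by_contra hcon
      have : |y| = 0 := le_antisymm (not_lt.1 hcon) (abs_nonneg y)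
      rw [this] at hy; norm_num at hy
    have hy0 : y ≠ 0 := abs_pos.1 hypos
    have hterm : |deriv χ (R * y)| * R ≤ D * |y|⁻¹ := by
      rcases lt_or_ge 1 |R * y| with h1 | h1
      · rw [hderivχ _ h1]; simp; positivity
      · refine mul_le_mul (hχD _) ?_ hR.le hD0
        rw [← one_div, le_div_iff₀ hypos, ← hRy]; exact h1
    have hsq : (|y| ^ 2)⁻¹ ≤ 5 * R ^ 2 * (1 + (R * y) ^ 2)⁻¹ := by
      have h4 : (1 / 2) ^ 2 ≤ (R * y) ^ 2 := by
        rw [← sq_abs (R * y)]; gcongr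
      rw [← div_eq_mul_inv, le_div_iff₀ (by positivity), inv_mul_le_iff₀ (by positivity), sq_abs]
      nlinarith
    calc ‖deriv g y‖ ≤ ‖deriv K y‖ * |1 - χ (R * y)| + ‖K y‖ * (|deriv χ (R * y)| * R) := by
          rw [hgd]
          refine (norm_add_le _ _).trans_eq ?_
          rw [norm_mul, norm_mul, Complex.norm_real, Complex.norm_real, norm_neg, norm_mul,
            Real.norm_eq_abs, Real.norm_eq_abs, Real.norm_of_nonneg hR.le]
      _ ≤ A * (|y| ^ 2)⁻¹ * 1 + A * |y|⁻¹ * (D * |y|⁻¹) := by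
          gcongr
          · exact hK1 y hy0
          · exact hχle' _
          · exact hK0 y hy0
      _ = A * (1 + D) * (|y| ^ 2)⁻¹ := by ring
      _ ≤ A * (1 + D) * (5 * R ^ 2 * (1 + (R * y) ^ 2)⁻¹) := by gcongr
      _ = _ := by ring
  have hinteg : Integrable fun y : ℝ => 5 * A * (1 + D) * R ^ 2 * (1 + (R * y) ^ 2)⁻¹ :=
    (integrable_inv_one_add_sq.comp_mul_left' hR.ne').const_mul _
  have hval : ∫ y : ℝ, 5 * A * (1 + D) * R ^ 2 * (1 + (R * y) ^ 2)⁻¹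
      = 5 * A * (1 + D) * R * π := by
    rw [integral_const_mul, Measure.integral_comp_mul_left (fun u : ℝ => (1 + u ^ 2)⁻¹),
      integral_univ_inv_one_add_sq, abs_of_pos (inv_pos.2 hR), smul_eq_mul]
    field_simp
  have hhigh : ‖∫ y, eI (-2 * π * y * η) * g y‖ ≤ 5 * (1 + D) / 2 * A := by
    refine (norm_integral_eI_mul_le hgC hgc hη).trans ?_
    rw [div_le_iff₀ (by positivity)]
    refine (integral_mono (hgC.continuous_deriv le_rfl |>.norm.integrable_of_hasCompactSupport
      hgc.deriv.norm) hinteg hgbound).trans_eq ?_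
    rw [hval]; ring
  have hsplit : ∫ y, eI (-2 * π * y * η) * K y
      = (∫ y, eI (-2 * π * y * η) * (K y * (χ (R * y) : ℂ)))
        + ∫ y, eI (-2 * π * y * η) * g y := by
    have hec := continuous_eI_mul η
    have hχc := hχ.continuous
    rw [← integral_add]
    · congr 1; funext y; simp only [hg]; push_cast; ring
    · exact (hec.mul (hK.continuous.mul (by fun_prop))).integrable_of_hasCompactSupport
        hKc.mul_right.mul_left
    · exact (hec.mul hgC.continuous).integrable_of_hasCompactSupport hgc.mul_left
  rw [hsplit]
  have h1 := (norm_add_le _ _).trans (add_le_add (hlow R hR le_rfl) hhigh)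
  have h2 : 0 ≤ 2 / c * A + 5 * (1 + D) / 2 * B := by positivity
  linarith

/-- For `M` satisfying the flag-`F₁` seminorm bounds, the partial Fourier
transforms `M_η(x) = ∫ e^{-2πiyη} M(x,y) dy` form a uniformly bounded family of CZ kernels
on `ℝ`, with constants depending only on the flag constants (not on `η` or the support). -/
theorem partial_fourier_is_uniform_CZ_family (Cab : ℕ → ℕ → ℝ) (C1 : ℕ → ℝ) (C2 : ℝ) :
    ∃ (Cd : ℕ → ℝ) (C : ℝ), ∀ M : ℝ → ℝ → ℂ, FlagF1FunBounds Cab C1 C2 M →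
      ∀ η : ℝ,
        (∀ (α : ℕ) (x : ℝ), x ≠ 0 →
          ‖iteratedDeriv α (fun x' : ℝ => ∫ y : ℝ, eI (-2 * π * y * η) * M x' y) x‖
            ≤ Cd α * |x| ^ (-1 - (α : ℝ))) ∧
        (∀ δ : ℝ, 0 < δ → ∀ φ : ℝ → ℝ, IsNormalizedBump φ →
          ‖∫ x : ℝ, (∫ y : ℝ, eI (-2 * π * y * η) * M x y) * (φ (δ * x) : ℂ)‖ ≤ C) := by
  obtain ⟨E, hE0, hE⟩ := exists_norm_integral_eI_mul_le
  refine ⟨fun α => E * (|Cab α 0| + |Cab α 1| + C1 α), E * (|C1 0| + |C1 1| + C2), ?_⟩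
  rintro M ⟨hsm, hcs, hdec, hii⟩ η
  have hM : IsTestFun M := ⟨hsm, hcs⟩
  refine ⟨fun α x hx => ?_, fun δ hδ φ hφ => ?_⟩
  · have hxpos : 0 < |x| := abs_pos.2 hx
    have hN := hM.iterate_fstDeriv α
    have hexp : -1 - (α : ℝ) ≤ 0 := by linarith [(Nat.cast_nonneg α : (0 : ℝ) ≤ α)]
    have hbase : ∀ (β : ℕ) (y : ℝ), y ≠ 0 →
        Cab α β * (|x| + |y| ^ ((1:ℝ)/2)) ^ (-1 - (α : ℝ)) * |y| ^ (-1 - (β : ℝ))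
          ≤ |Cab α β| * |x| ^ (-1 - (α : ℝ)) * |y| ^ (-1 - (β : ℝ)) := by
      intro β y _
      have hr : (|x| + |y| ^ ((1:ℝ)/2)) ^ (-1 - (α : ℝ)) ≤ |x| ^ (-1 - (α : ℝ)) :=
        Real.rpow_le_rpow_of_nonpos hxpos (le_add_of_nonneg_right (by positivity)) hexp
      have h0 : 0 ≤ |x| + |y| ^ ((1:ℝ)/2) := by positivity
      gcongr
      exact le_abs_self _
    have key := hE (fstDeriv^[α] M x)
      ((|Cab α 0| + |Cab α 1|) * |x| ^ (-1 - (α : ℝ))) (C1 α * |x| ^ (-1 - (α : ℝ)))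
      ((hN.1.comp (contDiff_prodMk_right x)).of_le (by exact_mod_cast le_top))
      (hN.hasCompactSupport_snd x) ?_ ?_ ?_ η
    · simp only [mul_comm (eI _)] at key ⊢
      rw [hM.iteratedDeriv_integral (continuous_eI_mul η)]
      exact key.trans_eq (by ring)
    · intro y hy
      have h := (hdec α 0 x y hy).trans (hbase 0 y hy)
      simp only [iteratedDeriv_zero, IsTestFun.iteratedDeriv_fst] at h
      rw [Nat.cast_zero, sub_zero, Real.rpow_neg_one] at h
      refine h.trans ?_
      gcongr
      linarith [abs_nonneg (Cab α 1)]
    · intro y hy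
      have h := (hdec α 1 x y hy).trans (hbase 1 y hy)
      simp only [iteratedDeriv_one] at h
      have hcomm := congrFun₂ (hM.sndDeriv_iterate_fstDeriv α) x y
      rw [← IsTestFun.iteratedDeriv_fst (sndDeriv M) α x y] at hcomm
      unfold sndDeriv at hcomm
      rw [← hcomm, show -1 - ((1 : ℕ) : ℝ) = -((2 : ℕ) : ℝ) by norm_num,
        Real.rpow_neg (abs_nonneg y), Real.rpow_natCast] at h
      refine h.trans ?_
      gcongr
      linarith [abs_nonneg (Cab α 0)]
    · intro R hR ψ hψ
      have h := (hii ψ hψ R hR).2.2.1 α x hx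
      have hψc := hψ.1.continuous
      rwa [hM.iteratedDeriv_integral (by fun_prop)] at h
  · have hφc : Continuous fun x : ℝ => (φ (δ * x) : ℂ) := by
      have := hφ.1.continuous
      fun_prop
    have hec := continuous_eI_mul η
    have hswap : ∫ x : ℝ, (∫ y : ℝ, eI (-2 * π * y * η) * M x y) * (φ (δ * x) : ℂ)
        = ∫ y : ℝ, eI (-2 * π * y * η) * ∫ x : ℝ, M x y * (φ (δ * x) : ℂ) := by
      simp only [← integral_mul_const, ← integral_const_mul, mul_assoc (eI _)]
      refine integral_integral_swap (μ := volume) (ν := volume)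
        (f := fun x y => eI (-2 * π * y * η) * (M x y * (φ (δ * x) : ℂ))) ?_
      exact ((hec.comp continuous_snd).mul
        (hM.continuous.mul (hφc.comp continuous_fst))).integrable_of_hasCompactSupport
        hM.2.mul_right.mul_left
    rw [hswap]
    obtain ⟨L, hL, hL0⟩ := hM.exists_compact
    obtain ⟨hdecay, hcanc, -⟩ := hii φ hφ δ hδ
    refine hE (fun y => ∫ x : ℝ, M x y * (φ (δ * x) : ℂ)) (|C1 0| + |C1 1|) C2
      (hM.swap.contDiff_integral hφc)
      (HasCompactSupport.intro hL fun y hy => by simp [hL0 _ y hy]) ?_ ?_ hcanc η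
    · intro y hy
      have h := hdecay 0 y hy
      rw [iteratedDeriv_zero, Nat.cast_zero, sub_zero, Real.rpow_neg_one] at h
      refine h.trans ?_
      gcongr
      linarith [le_abs_self (C1 0), abs_nonneg (C1 1)]
    · intro y hy
      have h := hdecay 1 y hy
      rw [iteratedDeriv_one, show -1 - ((1 : ℕ) : ℝ) = -((2 : ℕ) : ℝ) by norm_num,
        Real.rpow_neg (abs_nonneg y), Real.rpow_natCast] at h
      refine h.trans ?_
      gcongr
      linarith [le_abs_self (C1 1), abs_nonneg (C1 0)]
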